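/- Let n ∈ ℕ₀, y ∈ [0,1), and c ∈ ℕ₀ with y ∈ [2^{−n}c, 2^{−n}(c+1)). If c is even, then for x ∈ [0,1): χ_n(x,y) = 2^n if x ∈ [2^{−n}c, y] ∪ [2^{−n}(c+1), y + 2^{−n}], and χ_n(x,y) = 0 otherwise. If c is odd, then for x ∈ [0,1): χ_n(x,y) = 2^n if x ∈ [y − 2^{−n}, 2^{−n}c) ∪ [y, 2^{−n}(c+1)), and χ_n(x,y) = 0 otherwise. -/

import Mathlib

open MeasureTheory Finset
open scoped ENNReal

noncomputable section

/-- The `j`-th binary digit (`j ≥ 1`) of a real number `x ∈ [0,1)`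
(using the binary expansion in which infinitely many digits are `0`). -/
def bdigit (x : ℝ) (j : ℕ) : ℕ := ⌊x * 2 ^ j⌋.toNat % 2

/-- The `k`-th (dyadic) Walsh function. -/
def walsh (k : ℕ) (x : ℝ) : ℝ :=
  (-1 : ℝ) ^ (∑ j ∈ Finset.range k, if k.testBit j then bdigit x (j + 1) else 0)

/-- The multi-dimensional Walsh function. -/
def walshV {s : ℕ} (k : Fin s → ℕ) (x : Fin s → ℝ) : ℝ := ∏ i, walsh (k i) (x i)

/-- The half-open unit cube `[0,1)^s`. -/
def unitCube (s : ℕ) : Set (Fin s → ℝ) := Set.univ.pi fun _ => Set.Ico (0 : ℝ) 1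

/-- The closed unit cube `[0,1]^s`. -/
def closedCube (s : ℕ) : Set (Fin s → ℝ) := Set.univ.pi fun _ => Set.Icc (0 : ℝ) 1

/-- The `k`-th Walsh coefficient of `f`. -/
def walshCoeff {s : ℕ} (f : (Fin s → ℝ) → ℝ) (k : Fin s → ℕ) : ℝ :=
  ∫ x in unitCube s, f x * walshV k x

/-- `z ⊕ 2^{-n}` : flipping the `n`-th binary digit of `z`. -/
def oplus (z : ℝ) (n : ℕ) : ℝ := z + (-1) ^ bdigit z n * ((2 : ℝ) ^ n)⁻¹

/-- The dyadic difference `∂_{i,n}`. -/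
def dyadicDiff {s : ℕ} (i : Fin s) (n : ℕ) (g : (Fin s → ℝ) → ℝ) (x : Fin s → ℝ) : ℝ :=
  2 ^ n * (g (Function.update x i (oplus (x i) n)) - g x)

/-- The function `χ_n`. -/
def chi (n : ℕ) (x y : ℝ) : ℝ :=
  if min x (oplus x n) ≤ y ∧ y ≤ max x (oplus x n) then 2 ^ n else 0

/-- The exponents in the binary expansion of `k`, in decreasing order. -/
def bitsDesc (k : ℕ) : List ℕ := ((List.range k).filter fun j => k.testBit j).reverse

/-- The number `N` of nonzero binary digits of `k`. -/
def numBits (k : ℕ) : ℕ := (bitsDesc k).length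

/-- The weight `μ'_u(k) = ∑_{j=1}^{min(u,N)} (a_j + 2)` for scalar `k`. -/
def muW (u k : ℕ) : ℕ := (((bitsDesc k).take u).map (· + 2)).sum

/-- The weight `μ'_u(k)` for vectors. -/
def muWV {s : ℕ} (u k : Fin s → ℕ) : ℕ := ∑ i, muW (u i) (k i)

/-- `k_{≤}^{u}` : the `u` most significant binary digits of `k`. -/
def kLe (u k : ℕ) : ℕ := (((bitsDesc k).take u).map (2 ^ ·)).sum

/-- `k_{>}^{u}` : the remaining binary digits of `k`. -/
def kGt (u k : ℕ) : ℕ := (((bitsDesc k).drop u).map (2 ^ ·)).sum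

/-- The functions `W(k)`, defined inductively by stripping the least significant
binary digit of `k` (whose exponent is the 2-adic valuation of `k`). -/
def Wfun : ℕ → ℝ → ℝ
  | 0 => fun _ => 1
  | (k + 1) => fun y =>
      ∫ x in Set.Ico (0 : ℝ) 1,
        chi ((k + 1).factorization 2 + 1) x y *
          Wfun ((k + 1) - 2 ^ ((k + 1).factorization 2)) x
  decreasing_by exact Nat.sub_lt (Nat.succ_pos k) (Nat.two_pow_pos _)

/-- Composition of the dyadic differences `∂_{i,a+1}` for `a` running over a list. -/
def dCompCoord {s : ℕ} (i : Fin s) (L : List ℕ) (g : (Fin s → ℝ) → ℝ) : (Fin s → ℝ) → ℝ :=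
  L.foldr (fun a h => dyadicDiff i (a + 1) h) g

/-- The operator `d_{k_u}` : composition over all coordinates `i` of the dyadic
differences `∂_{i,a_{i,j}+1}`, `1 ≤ j ≤ min(u_i, N_i)`. -/
def dComp {s : ℕ} (u k : Fin s → ℕ) (f : (Fin s → ℝ) → ℝ) : (Fin s → ℝ) → ℝ :=
  (List.finRange s).foldr (fun i g => dCompCoord i ((bitsDesc (k i)).take (u i)) g) f

/-- The multi-index `ν` increased by one in coordinate `i`. -/
def addE {s : ℕ} (i : Fin s) (ν : Fin s → ℕ) : Fin s → ℕ := Function.update ν i (ν i + 1)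

/-- `D` is a family of mixed partial derivatives of `f`, of orders up to `u_i` in
the variable `x_i`, each continuous on the closed cube `[0,1]^s`. -/
def HasMixedDerivs {s : ℕ} (u : Fin s → ℕ) (f : (Fin s → ℝ) → ℝ)
    (D : (Fin s → ℕ) → (Fin s → ℝ) → ℝ) : Prop :=
  D (fun _ => 0) = f ∧
    (∀ ν : Fin s → ℕ, (∀ j, ν j ≤ u j) → ContinuousOn (D ν) (closedCube s)) ∧
    ∀ (ν : Fin s → ℕ) (i : Fin s), (∀ j, addE i ν j ≤ u j) →
      ∀ x ∈ closedCube s,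
        HasDerivWithinAt (fun t => D ν (Function.update x i t)) (D (addE i ν) x)
          (Set.Icc 0 1) (x i)

/-- `∫_{[0,1)^{s-|v|}} F dx_{S∖v}` : the inner integral over the coordinates outside `v`
(as a function of the coordinates in `v`). -/
def projInt {s : ℕ} (v : Finset (Fin s)) (F : (Fin s → ℝ) → ℝ) (x : Fin s → ℝ) : ℝ :=
  ∫ y in unitCube s, F fun i => if i ∈ v then x i else y i

/-- The mixed norm `‖F^{(·)}‖_p` : the `L^p` norm (over the coordinates in `v`) of the
integral of `F` over the coordinates outside `v`. -/
def mixedNorm {s : ℕ} (p : ℝ≥0∞) (v : Finset (Fin s)) (F : (Fin s → ℝ) → ℝ) : ℝ≥0∞ :=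
  eLpNorm (projInt v F) p (volume.restrict (unitCube s))

/-- The `ℓ^q` norm of a finite family in `ℝ≥0∞`, with the usual modification at `q = ∞`. -/
def lqNorm {ι : Type*} [Fintype ι] (q : ℝ≥0∞) (a : ι → ℝ≥0∞) : ℝ≥0∞ :=
  if q = ∞ then ⨆ i, a i else (∑ i, a i ^ q.toReal) ^ q.toReal⁻¹

/-- The `h`-th point of the digital net generated by the matrices `C i`. -/
def netPoint {s m n : ℕ} (C : Fin s → Matrix (Fin n) (Fin m) (ZMod 2)) (h : Fin (2 ^ m)) :
    Fin s → ℝ :=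
  fun i => ∑ j : Fin n,
    (((∑ l : Fin m, (if (h : ℕ).testBit (l : ℕ) then (1 : ZMod 2) else 0) * C i j l).val : ℝ) *
      ((2 : ℝ) ^ ((j : ℕ) + 1))⁻¹)

/-- Membership of `k ∈ ℕ₀^s` in the dual net `P^⊥`. -/
def inDual {s m n : ℕ} (C : Fin s → Matrix (Fin n) (Fin m) (ZMod 2)) (k : Fin s → ℕ) : Prop :=
  ∀ l : Fin m, ∑ i, ∑ j : Fin n, C i j l * (if (k i).testBit (j : ℕ) then (1 : ZMod 2) else 0) = 0

open Classical in
/-- `∑_{k_v ∈ P_v^⊥} 2^{-μ'_α(k_v)}`, encoded as a sum over all `k ∈ ℕ₀^s`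
with support exactly `v` lying in the dual net. -/
def dualSum {s m n : ℕ} (α : ℕ) (C : Fin s → Matrix (Fin n) (Fin m) (ZMod 2))
    (v : Finset (Fin s)) : ℝ≥0∞ :=
  ∑' k : Fin s → ℕ,
    if (∀ i, i ∈ v ↔ k i ≠ 0) ∧ inDual C k
    then (2 : ℝ≥0∞) ^ (-(muWV (fun _ => α) k : ℝ)) else 0


theorem bdigit_eq_natFloor (x : ℝ) (j : ℕ) : bdigit x j = ⌊x * 2 ^ j⌋₊ % 2 := by
  rw [bdigit, Int.floor_toNat]

/-- If the `n`-th binary digit of `x` is `0`, then flipping it moves `x` to the right. -/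
theorem chi_of_even {n : ℕ} {x : ℝ} (h : Even ⌊x * 2 ^ n⌋₊) (y : ℝ) :
    chi n x y = (Set.Icc (y - ((2 : ℝ) ^ n)⁻¹) y).indicator (fun _ => (2 : ℝ) ^ n) x := by
  have hr : (0 : ℝ) < ((2 : ℝ) ^ n)⁻¹ := by positivity
  have ho : oplus x n = x + ((2 : ℝ) ^ n)⁻¹ := by
    rw [oplus, bdigit_eq_natFloor, Nat.even_iff.mp h, pow_zero, one_mul]
  rw [chi, ho, min_eq_left (by linarith), max_eq_right (by linarith), Set.indicator_apply]
  simp only [Set.mem_Icc, sub_le_iff_le_add, and_comm]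

/-- If the `n`-th binary digit of `x` is `1`, then flipping it moves `x` to the left. -/
theorem chi_of_odd {n : ℕ} {x : ℝ} (h : Odd ⌊x * 2 ^ n⌋₊) (y : ℝ) :
    chi n x y = (Set.Icc y (y + ((2 : ℝ) ^ n)⁻¹)).indicator (fun _ => (2 : ℝ) ^ n) x := by
  have hr : (0 : ℝ) < ((2 : ℝ) ^ n)⁻¹ := by positivity
  have ho : oplus x n = x - ((2 : ℝ) ^ n)⁻¹ := by
    rw [oplus, bdigit_eq_natFloor, Nat.odd_iff.mp h]
    ring
  rw [chi, ho, min_eq_right (by linarith), max_eq_left (by linarith), Set.indicator_apply]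
  simp only [Set.mem_Icc, sub_le_iff_le_add, and_comm]

theorem natFloor_mul_two_pow_bounds {x : ℝ} (hx : 0 ≤ x) (n : ℕ) :
    (⌊x * 2 ^ n⌋₊ : ℝ) * ((2 : ℝ) ^ n)⁻¹ ≤ x ∧
      x < ((⌊x * 2 ^ n⌋₊ : ℝ) + 1) * ((2 : ℝ) ^ n)⁻¹ := by
  have h2 : (0 : ℝ) < 2 ^ n := by positivity
  rw [← div_eq_mul_inv, ← div_eq_mul_inv, div_le_iff₀ h2, lt_div_iff₀ h2]
  exact ⟨Nat.floor_le (by positivity), Nat.lt_floor_add_one _⟩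

/-- Lemma `chi_y`: description of `χ_n(⋅,y)` as a characteristic
function in `x`, for `y ∈ [2^{-n}c, 2^{-n}(c+1))`, according to the parity of `c`. -/
theorem stmt11 (n : ℕ) (y : ℝ) (hy : y ∈ Set.Ico (0 : ℝ) 1) (c : ℕ)
    (hc : y ∈ Set.Ico ((c : ℝ) * ((2 : ℝ) ^ n)⁻¹) (((c : ℝ) + 1) * ((2 : ℝ) ^ n)⁻¹)) :
    (Even c → ∀ x ∈ Set.Ico (0 : ℝ) 1,
      chi n x y =
        (Set.Icc ((c : ℝ) * ((2 : ℝ) ^ n)⁻¹) y ∪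
            Set.Icc (((c : ℝ) + 1) * ((2 : ℝ) ^ n)⁻¹) (y + ((2 : ℝ) ^ n)⁻¹)).indicator
          (fun _ => (2 : ℝ) ^ n) x) ∧
    (Odd c → ∀ x ∈ Set.Ico (0 : ℝ) 1,
      chi n x y =
        (Set.Ico (y - ((2 : ℝ) ^ n)⁻¹) ((c : ℝ) * ((2 : ℝ) ^ n)⁻¹) ∪
            Set.Ico y (((c : ℝ) + 1) * ((2 : ℝ) ^ n)⁻¹)).indicator
          (fun _ => (2 : ℝ) ^ n) x) := by
  have hr : (0 : ℝ) < ((2 : ℝ) ^ n)⁻¹ := by positivity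
  obtain ⟨hc₁, hc₂⟩ := hc
  constructor
  all_goals
    intro hpar x hx
    obtain ⟨hk₁, hk₂⟩ := natFloor_mul_two_pow_bounds hx.1 n
    rcases Nat.even_or_odd ⌊x * 2 ^ n⌋₊ with hk | hk
    on_goal 1 => rw [chi_of_even hk]
    on_goal 2 => rw [chi_of_odd hk]
  all_goals
    generalize ⌊x * 2 ^ n⌋₊ = k at *
    generalize ((2 : ℝ) ^ n)⁻¹ = r at *
    simp only [Set.indicator_apply, Set.mem_union, Set.mem_Icc, Set.mem_Ico]
    congr 1
    apply propext
    have hlt : k < c → ((k : ℝ) + 1) * r ≤ c * r := fun h =>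
      mul_le_mul_of_nonneg_right (by exact_mod_cast h) hr.le
    have hlt' : k + 1 < c → ((k : ℝ) + 2) * r ≤ c * r := fun h =>
      mul_le_mul_of_nonneg_right (by exact_mod_cast h) hr.le
    have hgt : c < k → ((c : ℝ) + 1) * r ≤ k * r := fun h =>
      mul_le_mul_of_nonneg_right (by exact_mod_cast h) hr.le
    have hgt' : c + 1 < k → ((c : ℝ) + 2) * r ≤ k * r := fun h =>
      mul_le_mul_of_nonneg_right (by exact_mod_cast h) hr.le
    obtain h | h | h | h | h : k + 1 < c ∨ k + 1 = c ∨ k = c ∨ k = c + 1 ∨ c + 1 < k := by omega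
    all_goals grind

end
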